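/- Let 𝒜 be a symmetric W-tensor of even order m and dimension n. Then λ_max(𝒜) = min{ t ∈ ℝ : there exists μ ∈ ℝ such that the polynomial t − 𝒜x^m + μ(Σ_{i=1}^n x_i^m − 1) is a sums-of-squares polynomial }, and this minimum is attained (in particular at t = μ = λ_max(𝒜)). -/

import Mathlib

open MvPolynomial Finset

noncomputable section

/-- `tmul A x = 𝒜 x^m`, the homogeneous form associated with an
`m`-th order `n`-dimensional tensor `A`. -/
def tmul {m n : ℕ} (A : (Fin m → Fin n) → ℝ) (x : Fin n → ℝ) : ℝ :=
  ∑ g : Fin m → Fin n, A g * ∏ j, x (g j)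

/-- A tensor is symmetric if its entries are invariant under permutations of the indices. -/
def IsSymT {m n : ℕ} (A : (Fin m → Fin n) → ℝ) : Prop :=
  ∀ (σ : Equiv.Perm (Fin m)) (g : Fin m → Fin n), A (g ∘ σ) = A g

/-- `lam` is an H-eigenvalue of a tensor of order `m + 1`:
there is a nonzero `x` with `𝒜 x^m = lam * x^{[m]}`. -/
def IsHEig {m n : ℕ} (A : (Fin (m + 1) → Fin n) → ℝ) (lam : ℝ) : Prop :=
  ∃ x : Fin n → ℝ, x ≠ 0 ∧ ∀ i : Fin n,
    (∑ g : Fin m → Fin n, A (Fin.cons i g) * ∏ j, x (g j)) = lam * x i ^ m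

/-- `𝒜_Γ x_Γ^m` for a subtensor `B` indexed by an index set `Γ ⊆ {1,…,n}`. -/
def subTmul {m n : ℕ} (Γ : Finset (Fin n)) (B : (Fin m → Γ) → ℝ) (x : Fin n → ℝ) : ℝ :=
  ∑ g : Fin m → Γ, B g * ∏ j, x (g j).1

/-- An index tuple is off-diagonal if not all of its entries coincide. -/
def NotDiag {m : ℕ} {I : Type*} (g : Fin m → I) : Prop := ¬ ∀ j j' : Fin m, g j = g j'

/-- Condition (iii) in the definition of a W-tensor, for one subtensor. -/
def WCondIII {m n : ℕ} {Γ : Finset (Fin n)} (B : (Fin m → Γ) → ℝ) : Prop :=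
  (∃ gb : Fin m → Γ, NotDiag gb ∧ ∀ g : Fin m → Γ, NotDiag g →
      (∀ σ : Equiv.Perm (Fin m), g ≠ gb ∘ σ) → B g = 0) ∨
  (∀ g : Fin m → Γ, NotDiag g → 0 ≤ B g)

/-- Condition (i) in the definition of a W-tensor. -/
def WCondI {n s : ℕ} (Γ : Fin s → Finset (Fin n)) : Prop :=
  ∀ p : Fin s, 0 < (p : ℕ) →
    (((Finset.univ.filter fun l => l < p).biUnion Γ) ∩ Γ p).card ≤ 1

/-- W-tensor. -/
def IsWTensor {m n : ℕ} (A : (Fin m → Fin n) → ℝ) : Prop :=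
  ∃ (s : ℕ) (Γ : Fin s → Finset (Fin n)) (B : ∀ l : Fin s, (Fin m → Γ l) → ℝ),
    0 < s ∧ s ≤ n ∧
    Function.Injective Γ ∧
    Finset.univ.biUnion Γ = Finset.univ ∧
    WCondI Γ ∧
    (∀ x : Fin n → ℝ, tmul A x = ∑ l, subTmul (Γ l) (B l) x) ∧
    (∀ l, WCondIII (B l))

/-- Sums of squares of polynomials. -/
def IsSOSPoly {σ : Type*} (p : MvPolynomial σ ℝ) : Prop :=
  ∃ (r : ℕ) (q : Fin r → MvPolynomial σ ℝ), p = ∑ j, q j ^ 2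

/-- The polynomial `𝒜 x^m` as a formal multivariate polynomial. -/
def tpoly {m n : ℕ} (A : (Fin m → Fin n) → ℝ) : MvPolynomial (Fin n) ℝ :=
  ∑ g : Fin m → Fin n, MvPolynomial.C (A g) * ∏ j, MvPolynomial.X (g j)

/-- The polynomial `𝒜_Γ x_Γ^m` of a subtensor, in the variables `x_Γ`. -/
def subTpoly {m n : ℕ} (Γ : Finset (Fin n)) (B : (Fin m → Γ) → ℝ) : MvPolynomial Γ ℝ :=
  ∑ g : Fin m → Γ, MvPolynomial.C (B g) * ∏ j, MvPolynomial.X (g j)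

/-- A (symmetric) tensor is copositive if `𝒜 x^m ≥ 0` for all entrywise-nonnegative `x`. -/
def Copositive {m n : ℕ} (A : (Fin m → Fin n) → ℝ) : Prop :=
  ∀ x : Fin n → ℝ, (∀ i, 0 ≤ x i) → 0 ≤ tmul A x

theorem IsSumSq.algebraMap_mul {R : Type*} [CommRing R] [Algebra ℝ R] {c : ℝ} (hc : 0 ≤ c)
    {a : R} (ha : IsSumSq a) : IsSumSq (algebraMap ℝ R c * a) := by
  refine IsSumSq.mul ?_ ha
  rw [← Real.mul_self_sqrt hc, map_mul]
  exact IsSumSq.mul_self _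

theorem IsSumSq.pow_nat {R : Type*} [CommRing R] {a : R} (ha : IsSumSq a) (k : ℕ) :
    IsSumSq (a ^ k) := by
  induction k with
  | zero => rw [pow_zero]; exact IsSumSq.one
  | succ k ih => rw [pow_succ]; exact ih.mul ha

/-- The product of two differences of powers of sums of squares is a sum of squares. -/
theorem IsSumSq.pow_sub_pow_mul_sub {R : Type*} [CommRing R] {a b : R} (ha : IsSumSq a)
    (hb : IsSumSq b) (k : ℕ) : IsSumSq ((a ^ k - b ^ k) * (a - b)) := by
  rw [← geom_sum₂_mul a b k, mul_assoc]
  exact IsSumSq.mul (IsSumSq.sum fun i _ => (ha.pow_nat _).mul (hb.pow_nat _)) (IsSumSq.mul_self _)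

/-- Hurwitz's form of the AM-GM inequality: the defect is a sum of squares as soon as the
entries are. -/
theorem IsSumSq.sum_pow_card_sub_card_mul_prod {R ι : Type*} [CommRing R] [Algebra ℝ R]
    [DecidableEq ι] {t : ι → R} (ht : ∀ i, IsSumSq (t i)) (k : ℕ) (s : Finset ι)
    (hs : s.card = k) : IsSumSq (∑ i ∈ s, t i ^ k - (k : R) * ∏ i ∈ s, t i) := by
  induction k generalizing s with
  | zero =>
    rw [Finset.card_eq_zero] at hs
    subst hs
    simp
  | succ k ih =>
    rcases Nat.eq_zero_or_pos k with rfl | hk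
    · obtain ⟨a, rfl⟩ := Finset.card_eq_one.mp hs
      simp
    have h1 : IsSumSq (∑ i ∈ s, t i * (∑ j ∈ s.erase i, t j ^ k - (k : R) * ∏ j ∈ s.erase i, t j)) := by
      refine IsSumSq.sum fun i hi => (ht i).mul (ih _ ?_)
      rw [Finset.card_erase_of_mem hi, hs]; rfl
    have h2 : IsSumSq (algebraMap ℝ R (1 / 2) *
        ∑ i ∈ s, ∑ j ∈ s, (t i ^ k - t j ^ k) * (t i - t j)) :=
      IsSumSq.algebraMap_mul (by norm_num)
        (IsSumSq.sum fun i _ => IsSumSq.sum fun j _ => (ht i).pow_sub_pow_mul_sub (ht j) k)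
    have e1 : ∑ i ∈ s, t i * (∑ j ∈ s.erase i, t j ^ k - (k : R) * ∏ j ∈ s.erase i, t j)
        = (∑ i ∈ s, t i) * (∑ j ∈ s, t j ^ k) - ∑ i ∈ s, t i ^ (k + 1)
          - ((k : R) + 1) * k * ∏ i ∈ s, t i := by
      have : ∀ i ∈ s, t i * (∑ j ∈ s.erase i, t j ^ k - (k : R) * ∏ j ∈ s.erase i, t j)
          = t i * (∑ j ∈ s, t j ^ k) - t i ^ (k + 1) - k * ∏ i ∈ s, t i := by
        intro i hi
        rw [← Finset.mul_prod_erase s t hi, ← Finset.add_sum_erase s (fun j => t j ^ k) hi]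
        ring
      rw [Finset.sum_congr rfl this]
      simp only [Finset.sum_sub_distrib, ← Finset.sum_mul, Finset.sum_const, hs, nsmul_eq_mul]
      push_cast
      ring
    have e2 : ∑ i ∈ s, ∑ j ∈ s, (t i ^ k - t j ^ k) * (t i - t j)
        = 2 * (((k : R) + 1) * ∑ i ∈ s, t i ^ (k + 1) - (∑ i ∈ s, t i) * (∑ j ∈ s, t j ^ k)) := by
      have : ∀ i ∈ s, ∑ j ∈ s, (t i ^ k - t j ^ k) * (t i - t j)
          = ((k : R) + 1) * t i ^ (k + 1) - t i ^ k * (∑ j ∈ s, t j) - t i * (∑ j ∈ s, t j ^ k)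
            + ∑ j ∈ s, t j ^ (k + 1) := by
        intro i hi
        have : ∀ j ∈ s, (t i ^ k - t j ^ k) * (t i - t j)
          = t i ^ (k + 1) - t i ^ k * t j - t i * t j ^ k + t j ^ (k + 1) := fun j _ => by ring
        rw [Finset.sum_congr rfl this]
        simp only [Finset.sum_sub_distrib, Finset.sum_add_distrib, ← Finset.mul_sum,
          Finset.sum_const, hs, nsmul_eq_mul]
        push_cast
        ring
      rw [Finset.sum_congr rfl this]
      simp only [Finset.sum_sub_distrib, Finset.sum_add_distrib, ← Finset.mul_sum,
          ← Finset.sum_mul, Finset.sum_const, hs, nsmul_eq_mul]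
      push_cast
      ring
    have h3 := IsSumSq.algebraMap_mul (c := 1 / (k : ℝ)) (by positivity) (h1.add h2)
    rw [e1, e2] at h3
    have c1 : algebraMap ℝ R (1 / 2) * 2 = 1 := by
      rw [← map_ofNat (algebraMap ℝ R) 2, ← map_mul]; norm_num
    have c2 : algebraMap ℝ R (1 / (k : ℝ)) * k = 1 := by
      rw [← map_natCast (algebraMap ℝ R) k, ← map_mul, one_div_mul_cancel (by positivity), map_one]
    convert h3 using 1
    push_cast
    linear_combination (-(∑ i ∈ s, t i ^ (k + 1)) + (k + 1) * ∏ i ∈ s, t i) * c2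
      - algebraMap ℝ R (1 / (k : ℝ)) * (((k : R) + 1) * ∑ i ∈ s, t i ^ (k + 1) - (∑ i ∈ s, t i) * (∑ j ∈ s, t j ^ k)) * c1

/-- Hurwitz's theorem: the AM-GM form of even degree is a sum of squares. -/
theorem isSumSq_sum_pow_sub_mul_prod {R : Type*} [CommRing R] [Algebra ℝ R] {M : ℕ}
    (hM : Even M) (y : Fin M → R) : IsSumSq (∑ j, y j ^ M - (M : R) * ∏ j, y j) := by
  obtain ⟨k, rfl⟩ := hM
  have h1 := IsSumSq.sum_pow_card_sub_card_mul_prod (t := fun i : Fin k => y (Fin.castAdd k i) ^ 2)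
    (fun i => by rw [sq]; exact IsSumSq.mul_self _) k univ (by simp)
  have h2 := IsSumSq.sum_pow_card_sub_card_mul_prod (t := fun i : Fin k => y (Fin.natAdd k i) ^ 2)
    (fun i => by rw [sq]; exact IsSumSq.mul_self _) k univ (by simp)
  have h3 : IsSumSq ((k : R) * ((∏ i : Fin k, y (Fin.castAdd k i) - ∏ i : Fin k, y (Fin.natAdd k i))
      * (∏ i : Fin k, y (Fin.castAdd k i) - ∏ i : Fin k, y (Fin.natAdd k i)))) :=
    (IsSumSq.natCast k).mul (IsSumSq.mul_self _)
  refine Eq.mp (congrArg IsSumSq ?_) ((h1.add h2).add h3)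
  rw [Fin.sum_univ_add, Fin.prod_univ_add]
  simp only [← pow_mul, Finset.prod_pow, ← two_mul]
  push_cast
  ring

open Filter Topology in
/-- Auxiliary weights: a form that is nonnegative on the orthant becomes, after an arbitrarily
small diagonal increase, a diagonal form dominated termwise by AM-GM forms. -/
theorem exists_weights_of_pos {n M : ℕ} (hM : 2 ≤ M) {T : Type*} [Fintype T] (d : Fin n → ℝ)
    (b : T → ℝ) (hb : ∀ τ, 0 ≤ b τ) (g : T → Fin M → Fin n)
    (h : ∀ x : Fin n → ℝ, (∀ i, 0 ≤ x i) → 0 ≤ ∑ i, d i * x i ^ M - ∑ τ, b τ * ∏ j, x (g τ j))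
    {δ : ℝ} (hδ : 0 < δ) :
    ∃ v : T → Fin M → ℝ, (∀ τ j, 0 ≤ v τ j) ∧ (∀ τ, ∏ j, (M * v τ j) = b τ ^ M) ∧
      ∀ i, ∑ τ, ∑ j, (if g τ j = i then v τ j else 0) ≤ d i + δ := by
  have hM0 : (0 : ℝ) < M := by positivity
  let G : (Fin n → ℝ) → ℝ := fun z => ∑ i, d i * Real.exp (M * z i)
    - ∑ τ, b τ * Real.exp (∑ j, z (g τ j)) + δ * ∑ i, (Real.exp (M * z i) - z i)
  have hGc : Continuous G := by fun_prop
  have hexp : ∀ t : ℝ, |t| ≤ Real.exp (M * t) - t := by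
    intro t
    have hM2 : (2 : ℝ) ≤ M := by exact_mod_cast hM
    rcases le_total 0 t with ht | ht
    · rw [abs_of_nonneg ht]
      nlinarith [Real.add_one_le_exp (M * t)]
    · rw [abs_of_nonpos ht]
      linarith [Real.exp_pos (M * t)]
  have hGl : ∀ z, δ * ‖z‖ ≤ G z := by
    intro z
    have h1 : 0 ≤ ∑ i, d i * Real.exp (M * z i) - ∑ τ, b τ * Real.exp (∑ j, z (g τ j)) := by
      have := h (fun i => Real.exp (z i)) fun i => (Real.exp_pos _).le
      simpa only [← Real.exp_nat_mul, ← Real.exp_sum] using this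
    have h2 : ‖z‖ ≤ ∑ i, (Real.exp (M * z i) - z i) := by
      have h0 : ∀ i, 0 ≤ Real.exp (M * z i) - z i := fun i => (abs_nonneg _).trans (hexp _)
      refine (pi_norm_le_iff_of_nonneg (Finset.sum_nonneg fun i _ => h0 i)).2 fun i => ?_
      exact (hexp (z i)).trans
        (Finset.single_le_sum (f := fun i => Real.exp (M * z i) - z i) (fun i _ => h0 i) (mem_univ i))
    have := mul_le_mul_of_nonneg_left h2 hδ.le
    simp only [G]
    linarith
  obtain ⟨z, hz⟩ := hGc.exists_forall_le
    (tendsto_atTop_mono hGl ((tendsto_norm_cocompact_atTop).const_mul_atTop hδ))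
  have hstat : ∀ i, M * (d i + δ) * Real.exp (M * z i)
      = ∑ τ, b τ * ((∑ j, if g τ j = i then 1 else 0) * Real.exp (∑ j, z (g τ j))) + δ := by
    intro i
    have hE : ∀ a c : ℝ, HasDerivAt (fun t : ℝ => Real.exp (a + t * c)) (c * Real.exp a) 0 := by
      intro a c
      have := (((hasDerivAt_id (0 : ℝ)).mul_const c).const_add a).exp
      simpa [mul_comm] using this
    let s : Fin n → ℝ := fun k => if k = i then 1 else 0
    have hd : HasDerivAt (fun t : ℝ => ∑ k, d k * Real.exp (M * z k + t * (M * s k))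
        - ∑ τ, b τ * Real.exp (∑ j, z (g τ j) + t * ∑ j, s (g τ j))
        + δ * ∑ k, (Real.exp (M * z k + t * (M * s k)) - (z k + t * s k)))
        (∑ k, d k * (M * s k * Real.exp (M * z k))
        - ∑ τ, b τ * ((∑ j, s (g τ j)) * Real.exp (∑ j, z (g τ j)))
        + δ * ∑ k, (M * s k * Real.exp (M * z k) - s k)) 0 := by
      refine ((HasDerivAt.fun_sum fun k _ => (hE _ _).const_mul _).sub
        (HasDerivAt.fun_sum fun k _ => (hE _ _).const_mul _)).add
        (HasDerivAt.const_mul _ (HasDerivAt.fun_sum fun k _ => (hE _ _).sub ?_))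
      simpa using (((hasDerivAt_id (0 : ℝ)).mul_const (s k)).const_add (z k))
    have hmin : IsLocalMin (fun t : ℝ => ∑ k, d k * Real.exp (M * z k + t * (M * s k))
        - ∑ τ, b τ * Real.exp (∑ j, z (g τ j) + t * ∑ j, s (g τ j))
        + δ * ∑ k, (Real.exp (M * z k + t * (M * s k)) - (z k + t * s k))) 0 := by
      refine Filter.Eventually.of_forall fun t => ?_
      convert hz (fun k => z k + t * s k) using 1
      · simp [G]
      · simp only [G, mul_add, Finset.sum_add_distrib, Finset.mul_sum]
        simp only [mul_left_comm]
    have := hmin.hasDerivAt_eq_zero hd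
    have e1 : ∑ k, d k * (M * s k * Real.exp (M * z k)) = d i * (M * Real.exp (M * z i)) := by
      simp [s]
    have e2 : ∑ k, (M * s k * Real.exp (M * z k) - s k) = M * Real.exp (M * z i) - 1 := by
      simp [s]
    rw [e1, e2] at this
    simp only [s] at this
    linarith
  refine ⟨fun τ j => b τ * Real.exp (∑ j, z (g τ j)) * Real.exp (-(M * z (g τ j))) / M,
    fun τ j => ?_, fun τ => ?_, fun i => ?_⟩
  · have := hb τ
    positivity
  · have : ∀ j, (M : ℝ) * (b τ * Real.exp (∑ j, z (g τ j)) * Real.exp (-(M * z (g τ j))) / M)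
        = b τ * Real.exp (∑ j, z (g τ j)) * Real.exp (-(M * z (g τ j))) := fun j => by
      field_simp
    simp only [this]
    rw [Finset.prod_mul_distrib, Finset.prod_const, Finset.card_fin, mul_pow, ← Real.exp_sum,
      Finset.sum_neg_distrib, ← Finset.mul_sum, mul_assoc, ← Real.exp_nat_mul, ← Real.exp_add,
      add_neg_cancel, Real.exp_zero, mul_one]
  · have e : ∑ τ, ∑ j, (if g τ j = i then
        b τ * Real.exp (∑ j, z (g τ j)) * Real.exp (-(M * z (g τ j))) / M else 0)
        = (∑ τ, b τ * ((∑ j, if g τ j = i then 1 else 0) * Real.exp (∑ j, z (g τ j))))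
          * (Real.exp (-(M * z i)) / M) := by
      rw [Finset.sum_mul]
      refine Finset.sum_congr rfl fun τ _ => ?_
      rw [Finset.sum_mul, Finset.mul_sum, Finset.sum_mul]
      refine Finset.sum_congr rfl fun j _ => ?_
      split_ifs with hj
      · rw [hj]; ring
      · ring
    have e' : ∑ τ, b τ * ((∑ j, if g τ j = i then 1 else 0) * Real.exp (∑ j, z (g τ j)))
        = M * (d i + δ) * Real.exp (M * z i) - δ := by linarith [hstat i]
    rw [e, e', sub_mul]
    have e3 : M * (d i + δ) * Real.exp (M * z i) * (Real.exp (-(M * z i)) / M) = d i + δ := by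
      rw [Real.exp_neg]
      field_simp
    rw [e3]
    have : 0 ≤ δ * (Real.exp (-(M * z i)) / M) := by positivity
    linarith

open Filter Topology in
theorem exists_weights {n M : ℕ} (hM : 2 ≤ M) {T : Type*} [Fintype T] (d : Fin n → ℝ)
    (b : T → ℝ) (hb : ∀ τ, 0 ≤ b τ) (g : T → Fin M → Fin n)
    (h : ∀ x : Fin n → ℝ, (∀ i, 0 ≤ x i) → 0 ≤ ∑ i, d i * x i ^ M - ∑ τ, b τ * ∏ j, x (g τ j)) :
    ∃ v : T → Fin M → ℝ, (∀ τ j, 0 ≤ v τ j) ∧ (∀ τ, ∏ j, (M * v τ j) = b τ ^ M) ∧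
      ∀ i, ∑ τ, ∑ j, (if g τ j = i then v τ j else 0) ≤ d i := by
  have hk : ∀ k : ℕ, (0 : ℝ) < 1 / ((k : ℝ) + 1) := fun k => by positivity
  choose v hv0 hvp hvs using fun k : ℕ => exists_weights_of_pos hM d b hb g h (hk k)
  have hbox : ∀ k, v k ∈ Set.Icc (0 : T → Fin M → ℝ) (fun τ j => d (g τ j) + 1) := by
    refine fun k => ⟨fun τ j => hv0 k τ j, fun τ j => ?_⟩
    have h0 : ∀ τ' j', 0 ≤ if g τ' j' = g τ j then v k τ' j' else 0 := fun τ' j' => by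
      split_ifs
      exacts [hv0 k τ' j', le_rfl]
    have h1 : v k τ j ≤ ∑ τ', ∑ j', (if g τ' j' = g τ j then v k τ' j' else 0) := by
      refine le_trans ?_ (Finset.single_le_sum
        (f := fun τ' => ∑ j', (if g τ' j' = g τ j then v k τ' j' else 0))
        (fun τ' _ => Finset.sum_nonneg fun j' _ => h0 τ' j') (mem_univ τ))
      refine le_trans ?_ (Finset.single_le_sum
        (f := fun j' => (if g τ j' = g τ j then v k τ j' else 0))
        (fun j' _ => h0 τ j') (mem_univ j))
      simp
    have h2 : 1 / ((k : ℝ) + 1) ≤ 1 := by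
      rw [div_le_one (by positivity)]
      linarith [Nat.cast_nonneg (α := ℝ) k]
    show v k τ j ≤ d (g τ j) + 1
    linarith [hvs k (g τ j)]
  obtain ⟨w, hw, φ, hφ, hlim⟩ := isCompact_Icc.tendsto_subseq hbox
  have hlim' : ∀ τ j, Tendsto (fun k => v (φ k) τ j) atTop (𝓝 (w τ j)) := fun τ j =>
    (tendsto_pi_nhds.1 ((tendsto_pi_nhds.1 hlim) τ)) j
  refine ⟨w, fun τ j => hw.1 τ j, fun τ => ?_, fun i => ?_⟩
  · refine tendsto_nhds_unique (tendsto_finsetProd _ fun j _ => (hlim' τ j).const_mul (M : ℝ)) ?_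
    simp only [hvp]
    exact tendsto_const_nhds
  · have h1 : Tendsto (fun k => ∑ τ, ∑ j, (if g τ j = i then v (φ k) τ j else 0)) atTop
        (𝓝 (∑ τ, ∑ j, (if g τ j = i then w τ j else 0))) := by
      refine tendsto_finsetSum _ fun τ _ => tendsto_finsetSum _ fun j _ => ?_
      split_ifs
      exacts [hlim' τ j, tendsto_const_nhds]
    have h2 : Tendsto (fun k => d i + 1 / ((φ k : ℝ) + 1)) atTop (𝓝 (d i + 0)) :=
      (tendsto_one_div_add_atTop_nhds_zero_nat.comp hφ.tendsto_atTop).const_add _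
    rw [add_zero] at h2
    exact le_of_tendsto_of_tendsto' h1 h2 fun k => hvs (φ k) i

/-- A real function on `ℝ^n` which is given by a sum of squares of polynomials. -/
def IsSOSFun {n : ℕ} (f : (Fin n → ℝ) → ℝ) : Prop :=
  ∃ p : MvPolynomial (Fin n) ℝ, IsSumSq p ∧ ∀ x, eval x p = f x

namespace IsSOSFun

variable {n : ℕ} {f f₁ f₂ : (Fin n → ℝ) → ℝ}

theorem congr (h : IsSOSFun f₁) (e : ∀ x, f₁ x = f₂ x) : IsSOSFun f₂ := by
  obtain ⟨p, hp, he⟩ := h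
  exact ⟨p, hp, fun x => (he x).trans (e x)⟩

theorem add (h₁ : IsSOSFun f₁) (h₂ : IsSOSFun f₂) : IsSOSFun fun x => f₁ x + f₂ x := by
  obtain ⟨p, hp, he⟩ := h₁
  obtain ⟨q, hq, hf⟩ := h₂
  exact ⟨p + q, hp.add hq, fun x => by rw [map_add, he, hf]⟩

theorem sum {ι : Type*} {s : Finset ι} {F : ι → (Fin n → ℝ) → ℝ} (h : ∀ i ∈ s, IsSOSFun (F i)) :
    IsSOSFun fun x => ∑ i ∈ s, F i x := by
  classical
  induction s using Finset.induction_on with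
  | empty => exact ⟨0, IsSumSq.zero, fun x => by simp⟩
  | insert a s ha ih =>
    refine ((h a (by simp)).add (ih fun i hi => h i (by simp [hi]))).congr fun x => ?_
    rw [Finset.sum_insert ha]

theorem const_mul (h : IsSOSFun f) {c : ℝ} (hc : 0 ≤ c) : IsSOSFun fun x => c * f x := by
  obtain ⟨p, hp, he⟩ := h
  exact ⟨C c * p, IsSumSq.algebraMap_mul hc hp, fun x => by rw [map_mul, eval_C, he]⟩

theorem diag {M : ℕ} (hM : Even M) {d : Fin n → ℝ} (hd : ∀ i, 0 ≤ d i) :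
    IsSOSFun fun x => ∑ i, d i * x i ^ M := by
  refine sum fun i _ => const_mul ?_ (hd i)
  obtain ⟨k, rfl⟩ := hM
  exact ⟨X i ^ k * X i ^ k, IsSumSq.mul_self _, fun x => by simp [pow_add]⟩

/-- A weighted AM-GM form is a sum of squares. -/
theorem amgm {M : ℕ} (hM : Even M) (hM2 : 2 ≤ M) {b : ℝ} {v : Fin M → ℝ} (hv : ∀ j, 0 ≤ v j)
    (hb : ∏ j, (M * v j) = |b| ^ M) (g : Fin M → Fin n) :
    IsSOSFun fun x => ∑ j, v j * x (g j) ^ M - b * ∏ j, x (g j) := by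
  have hM0 : (0 : ℝ) < M := by positivity
  have hMne : M ≠ 0 := by omega
  let r : Fin M → ℝ := fun j => (M * v j) ^ ((M : ℝ)⁻¹)
  have hr0 : ∀ j, 0 ≤ r j := fun j => Real.rpow_nonneg (mul_nonneg hM0.le (hv j)) _
  have hr : ∀ j, r j ^ M = M * v j := fun j =>
    Real.rpow_inv_natCast_pow (mul_nonneg hM0.le (hv j)) hMne
  have hrb : ∏ j, r j = |b| := by
    refine (pow_left_inj₀ (Finset.prod_nonneg fun j _ => hr0 j) (abs_nonneg b) hMne).1 ?_
    rw [← Finset.prod_pow, ← hb]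
    exact Finset.prod_congr rfl fun j _ => hr j
  obtain ⟨c, hc, hcb⟩ : ∃ c : Fin M → ℝ, (∀ j, c j ^ M = M * v j) ∧ ∏ j, c j = b := by
    rcases le_total 0 b with h | h
    · exact ⟨r, hr, by rw [hrb, abs_of_nonneg h]⟩
    · let j₀ : Fin M := ⟨0, by omega⟩
      refine ⟨fun j => (if j = j₀ then -1 else 1) * r j, fun j => ?_, ?_⟩
      · beta_reduce
        split_ifs
        · rw [neg_one_mul, hM.neg_pow, hr]
        · rw [one_mul, hr]
      · rw [Finset.prod_mul_distrib, hrb, abs_of_nonpos h]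
        simp
  have key : IsSOSFun fun x : Fin n → ℝ =>
      ∑ j, (c j * x (g j)) ^ M - (M : ℝ) * ∏ j, (c j * x (g j)) :=
    ⟨_, isSumSq_sum_pow_sub_mul_prod hM fun j => C (c j) * X (g j), fun x => by simp⟩
  refine (key.const_mul (c := (M : ℝ)⁻¹) (by positivity)).congr fun x => ?_
  simp only [mul_pow, hc, Finset.prod_mul_distrib, hcb, mul_assoc, ← Finset.mul_sum]
  field_simp

/-- A diagonal-minus-tail form which is nonnegative on the orthant once its tail coefficients
are replaced by their absolute values is a sum of squares. -/
theorem of_nonneg_abs {M : ℕ} (hM : Even M) (hM2 : 2 ≤ M) {T : Type*} [Fintype T] (d : Fin n → ℝ)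
    (b : T → ℝ) (g : T → Fin M → Fin n)
    (h : ∀ x : Fin n → ℝ, (∀ i, 0 ≤ x i) →
      0 ≤ ∑ i, d i * x i ^ M - ∑ τ, |b τ| * ∏ j, x (g τ j)) :
    IsSOSFun fun x => ∑ i, d i * x i ^ M - ∑ τ, b τ * ∏ j, x (g τ j) := by
  obtain ⟨v, hv, hvb, hvd⟩ := exists_weights hM2 d (fun τ => |b τ|) (fun τ => abs_nonneg _) g h
  refine ((diag hM fun i => sub_nonneg.2 (hvd i)).add
    (sum (s := univ) fun τ _ => amgm hM hM2 (hv τ) (hvb τ) (g τ))).congr fun x => ?_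
  have e : ∑ i, (∑ τ, ∑ j, if g τ j = i then v τ j else 0) * x i ^ M
      = ∑ τ, ∑ j, v τ j * x (g τ j) ^ M := by
    simp only [Finset.sum_mul]
    rw [Finset.sum_comm]
    refine Finset.sum_congr rfl fun τ _ => ?_
    rw [Finset.sum_comm]
    refine Finset.sum_congr rfl fun j _ => ?_
    simp
  simp only [sub_mul, Finset.sum_sub_distrib, e]
  ring

/-- A nonnegative form with a single off-diagonal monomial is a sum of squares. -/
theorem of_single {M : ℕ} (hM : Even M) (hM2 : 2 ≤ M) (d : Fin n → ℝ) (c : ℝ) (g : Fin M → Fin n)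
    (hg : NotDiag g) (h : ∀ x : Fin n → ℝ, 0 ≤ ∑ i, d i * x i ^ M - c * ∏ j, x (g j)) :
    IsSOSFun fun x => ∑ i, d i * x i ^ M - c * ∏ j, x (g j) := by
  by_cases hflip : 0 ≤ c ∨ ∃ i, Odd (#{j | g j = i})
  · refine (of_nonneg_abs hM hM2 d (fun _ : Unit => c) (fun _ => g) fun x _ => ?_).congr
      fun x => by simp
    simp only [Finset.univ_unique, Finset.sum_const, Finset.card_singleton, one_smul]
    rcases le_or_gt 0 c with hc | hc
    · rw [abs_of_nonneg hc]
      exact h x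
    · obtain ⟨i, hi⟩ := hflip.resolve_left (not_le.2 hc)
      have := h fun k => (if k = i then -1 else 1) * x k
      rw [abs_of_neg hc]
      have e1 : ∏ j, ((if g j = i then -1 else 1) * x (g j)) = - ∏ j, x (g j) := by
        rw [Finset.prod_mul_distrib, Finset.prod_ite, Finset.prod_const, Finset.prod_const_one,
          hi.neg_one_pow]
        ring
      have e2 : ∀ k, ((if k = i then -1 else 1) * x k) ^ M = x k ^ M := fun k => by
        split_ifs
        · rw [neg_one_mul, hM.neg_pow]
        · rw [one_mul]
      simp only [e1, e2] at this
      linarith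
  · push Not at hflip
    obtain ⟨hc, hev⟩ := hflip
    have hd : ∀ i, 0 ≤ d i := by
      intro i
      have := h (Pi.single i 1)
      have e1 : ∏ j, (Pi.single i (1 : ℝ) : Fin n → ℝ) (g j) = 0 := by
        by_contra hne
        refine hg fun j j' => ?_
        have hj : ∀ j, g j = i := fun j => by
          by_contra hji
          exact (Finset.prod_ne_zero_iff.1 hne j (mem_univ j)) (Pi.single_eq_of_ne hji _)
        rw [hj, hj]
      have e2 : ∑ k, d k * (Pi.single i (1 : ℝ) : Fin n → ℝ) k ^ M = d i := by
        rw [Finset.sum_eq_single i (fun k _ hk => by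
          rw [Pi.single_eq_of_ne hk, zero_pow (by omega), mul_zero]) (by simp)]
        simp
      rw [e1, e2] at this
      linarith
    have hsq : IsSOSFun fun x => ∏ j, x (g j) := by
      refine ⟨(∏ i, X i ^ (#{j | g j = i} / 2)) * ∏ i, X i ^ (#{j | g j = i} / 2),
        IsSumSq.mul_self _, fun x => ?_⟩
      have : ∏ j, x (g j) = ∏ i, x i ^ #{j | g j = i} := by
        rw [← Finset.prod_fiberwise univ g (fun j => x (g j))]
        refine Finset.prod_congr rfl fun i _ => ?_
        rw [Finset.prod_congr rfl (g := fun _ => x i) (by simp +contextual), Finset.prod_const]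
      beta_reduce
      rw [this, ← Finset.prod_mul_distrib, map_prod]
      refine Finset.prod_congr rfl fun i _ => ?_
      rw [← pow_add, ← two_mul, Nat.two_mul_div_two_of_even (Nat.not_odd_iff_even.1 (hev i))]
      simp
    refine ((diag hM hd).add (hsq.const_mul (neg_nonneg.2 hc.le))).congr fun x => ?_
    ring

end IsSOSFun

open Classical in
/-- Splitting a subtensor form into its diagonal and off-diagonal parts. -/
theorem exists_subTmul_eq_diag_add {n M : ℕ} (hM : 0 < M) {Γ : Finset (Fin n)}
    (B : (Fin M → Γ) → ℝ) : ∃ D : Fin n → ℝ, ∀ x, subTmul Γ B x = ∑ i, D i * x i ^ M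
      + ∑ g : Fin M → Γ, (if NotDiag g then B g else 0) * ∏ j, x (g j).1 := by
  let j₀ : Fin M := ⟨0, hM⟩
  refine ⟨fun i => ∑ g : Fin M → Γ, if (g j₀).1 = i then (if NotDiag g then 0 else B g) else 0,
    fun x => ?_⟩
  simp only [Finset.sum_mul, subTmul]
  rw [Finset.sum_comm, ← Finset.sum_add_distrib]
  refine Finset.sum_congr rfl fun g _ => ?_
  simp only [ite_mul, zero_mul, Finset.sum_ite_eq, Finset.mem_univ, if_true]
  split_ifs with hg
  · rw [zero_add]
  · have : ∀ j, g j = g j₀ := fun j => (not_not.1 hg) j j₀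
    simp only [this, add_zero, Finset.prod_const, Finset.card_fin]

/-- A nonnegative difference of a diagonal form and a subtensor form satisfying condition (iii)
is a sum of squares. -/
theorem WCondIII.isSOSFun {n M : ℕ} (hM : Even M) (hM2 : 2 ≤ M) {Γ : Finset (Fin n)}
    {B : (Fin M → Γ) → ℝ} (hB : WCondIII B) (d : Fin n → ℝ)
    (h : ∀ x : Fin n → ℝ, 0 ≤ ∑ i, d i * x i ^ M - subTmul Γ B x) :
    IsSOSFun fun x => ∑ i, d i * x i ^ M - subTmul Γ B x := by
  classical
  obtain ⟨D, hD⟩ := exists_subTmul_eq_diag_add (by omega) B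
  have hsplit : ∀ x : Fin n → ℝ, ∑ i, d i * x i ^ M - subTmul Γ B x
      = ∑ i, (d i - D i) * x i ^ M
        - ∑ g : Fin M → Γ, (if NotDiag g then B g else 0) * ∏ j, x (g j).1 := fun x => by
    rw [hD]
    simp only [sub_mul, Finset.sum_sub_distrib]
    ring
  simp only [hsplit] at h ⊢
  rcases hB with ⟨gb, hgb, hB⟩ | hB
  · have htail : ∀ x : Fin n → ℝ,
        ∑ g : Fin M → Γ, (if NotDiag g then B g else 0) * ∏ j, x (g j).1
          = (∑ g : Fin M → Γ, if NotDiag g then B g else 0) * ∏ j, x (gb j).1 := fun x => by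
      rw [Finset.sum_mul]
      refine Finset.sum_congr rfl fun g _ => ?_
      split_ifs with hg
      · by_cases hp : ∃ σ : Equiv.Perm (Fin M), g = gb ∘ σ
        · obtain ⟨σ, rfl⟩ := hp
          rw [← Equiv.prod_comp σ fun j => x (gb j).1]
          rfl
        · rw [hB g hg fun σ hσ => hp ⟨σ, hσ⟩, zero_mul, zero_mul]
      · rw [zero_mul, zero_mul]
    simp only [htail] at h ⊢
    refine IsSOSFun.of_single hM hM2 _ _ (fun j => (gb j).1) (fun hc => hgb fun j j' => ?_) h
    exact Subtype.ext (hc j j')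
  · refine IsSOSFun.of_nonneg_abs hM hM2 _ _ (fun (g : Fin M → Γ) j => (g j).1) fun x _ => ?_
    have : ∀ g : Fin M → Γ, |if NotDiag g then B g else 0| = if NotDiag g then B g else 0 :=
      fun g => by
        rw [abs_of_nonneg]
        split_ifs with hg
        exacts [hB g hg, le_rfl]
    simp only [this]
    exact h x

theorem subTmul_congr {n M : ℕ} {Γ : Finset (Fin n)} (B : (Fin M → Γ) → ℝ) {x y : Fin n → ℝ}
    (h : ∀ i ∈ Γ, x i = y i) : subTmul Γ B x = subTmul Γ B y := by
  refine Finset.sum_congr rfl fun g _ => ?_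
  rw [Finset.prod_congr rfl fun j _ => h _ (g j).2]

theorem subTmul_smul {n M : ℕ} {Γ : Finset (Fin n)} (B : (Fin M → Γ) → ℝ) (c : ℝ)
    (x : Fin n → ℝ) : subTmul Γ B (fun i => c * x i) = c ^ M * subTmul Γ B x := by
  simp only [subTmul, Finset.mul_sum, Finset.prod_mul_distrib, Finset.prod_const, Finset.card_fin]
  exact Finset.sum_congr rfl fun g _ => by ring

/-- If two homogeneous forms share only the variable `x_v` and their sum is nonnegative, then
a multiple of `x_v ^ M` can be moved between them to make both nonnegative. -/
theorem exists_shift_nonneg {n M : ℕ} (hM : Even M) (hM0 : M ≠ 0) {F H : (Fin n → ℝ) → ℝ}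
    (D : Finset (Fin n)) (v : Fin n) (hv : v ∉ D)
    (hF : ∀ x y : Fin n → ℝ, (∀ i ∉ D, x i = y i) → F x = F y)
    (hH : ∀ x y : Fin n → ℝ, (∀ i ∈ insert v D, x i = y i) → H x = H y)
    (hFh : ∀ (c : ℝ) (x : Fin n → ℝ), F (fun i => c * x i) = c ^ M * F x)
    (hHh : ∀ (c : ℝ) (x : Fin n → ℝ), H (fun i => c * x i) = c ^ M * H x)
    (hnn : ∀ x, 0 ≤ F x + H x) :
    ∃ θ : ℝ, (∀ x, 0 ≤ F x + θ * x v ^ M) ∧ ∀ x, 0 ≤ H x - θ * x v ^ M := by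
  have hglue : ∀ x z : Fin n → ℝ, x v = z v → 0 ≤ F x + H z := by
    intro x z hxz
    have := hnn fun i => if i ∈ D then z i else x i
    rwa [hF _ x fun i hi => if_neg hi, hH _ z fun i hi => ?_] at this
    rcases Finset.mem_insert.1 hi with rfl | hi
    · rw [if_neg hv, hxz]
    · exact if_pos hi
  have hF0 : F (fun _ => 0) = 0 := by simpa [hM0] using hFh 0 fun _ => 0
  let S : Set ℝ := H '' {z | z v = 1}
  have hbdd : ∀ x : Fin n → ℝ, x v = 1 → -F x ∈ lowerBounds S := by
    rintro x hx _ ⟨z, hz, rfl⟩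
    linarith [hglue x z (hx.trans hz.symm)]
  have hne : S.Nonempty := ⟨_, fun _ => 1, rfl, rfl⟩
  refine ⟨sInf S, fun x => ?_, fun x => ?_⟩
  · by_cases hx : x v = 0
    · rw [hx, zero_pow hM0, mul_zero, add_zero]
      have hH0 : H (fun _ => 0) = 0 := by simpa [hM0] using hHh 0 fun _ => 0
      simpa [hH0] using hglue x (fun _ => 0) hx
    · have h1 : -F (fun i => (x v)⁻¹ * x i) ≤ sInf S :=
        le_csInf hne (hbdd _ (inv_mul_cancel₀ hx))
      have h2 : F x = x v ^ M * F (fun i => (x v)⁻¹ * x i) := by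
        rw [hFh, ← mul_assoc, ← mul_pow, mul_inv_cancel₀ hx, one_pow, one_mul]
      rw [h2]
      nlinarith [hM.pow_nonneg (x v)]
  · by_cases hx : x v = 0
    · rw [hx, zero_pow hM0, mul_zero, sub_zero]
      simpa [hF0] using hglue (fun _ => 0) x hx.symm
    · have h1 : sInf S ≤ H (fun i => (x v)⁻¹ * x i) :=
        csInf_le ⟨_, hbdd (fun _ => 1) rfl⟩ ⟨_, inv_mul_cancel₀ hx, rfl⟩
      have h2 : H x = x v ^ M * H (fun i => (x v)⁻¹ * x i) := by
        rw [hHh, ← mul_assoc, ← mul_pow, mul_inv_cancel₀ hx, one_pow, one_mul]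
      rw [h2]
      nlinarith [hM.pow_nonneg (x v)]

/-- A nonnegative difference of a diagonal form and a form with W-tensor structure is a sum
of squares. -/
theorem WCondI.isSOSFun {n M s : ℕ} (hn : 0 < n) (hM : Even M) (hM2 : 2 ≤ M)
    {Γ : Fin s → Finset (Fin n)} (hΓ : WCondI Γ) {B : ∀ l : Fin s, (Fin M → Γ l) → ℝ}
    (hB : ∀ l, WCondIII (B l)) (k : ℕ) (hk : k ≤ s) (d : Fin n → ℝ)
    (h : ∀ x : Fin n → ℝ, 0 ≤ ∑ i, d i * x i ^ M
      - ∑ l with l.val < k, subTmul (Γ l) (B l) x) :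
    IsSOSFun fun x => ∑ i, d i * x i ^ M - ∑ l with l.val < k, subTmul (Γ l) (B l) x := by
  have hM0 : M ≠ 0 := by omega
  induction k generalizing d with
  | zero =>
    have hd : ∀ i, 0 ≤ d i := fun i => by
      have := h (Pi.single i 1)
      rwa [Finset.sum_eq_single i (fun k _ hk => by
        rw [Pi.single_eq_of_ne hk, zero_pow hM0, mul_zero]) (by simp), Pi.single_eq_same, one_pow,
        mul_one, Finset.sum_eq_zero (by simp), sub_zero] at this
    exact (IsSOSFun.diag hM hd).congr fun x => by simp
  | succ k ih =>
    have : Nonempty (Fin n) := ⟨⟨0, hn⟩⟩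
    let p : Fin s := ⟨k, hk⟩
    have hlt : (univ.filter fun l : Fin s => l.val < k + 1)
        = insert p (univ.filter fun l : Fin s => l.val < k) := by
      ext l
      simp only [mem_filter, mem_univ, true_and, mem_insert, Fin.ext_iff, p]
      omega
    have hsum : ∀ x, ∑ l with l.val < k + 1, subTmul (Γ l) (B l) x
        = subTmul (Γ p) (B p) x + ∑ l with l.val < k, subTmul (Γ l) (B l) x := fun x => by
      rw [hlt, Finset.sum_insert (by simp [p])]
    obtain ⟨v, hv⟩ : ∃ v, ∀ l : Fin s, l.val < k → Γ l ∩ Γ p ⊆ {v} := by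
      rcases Nat.eq_zero_or_pos k with rfl | hk0
      · exact ⟨⟨0, hn⟩, fun l hl => absurd hl (Nat.not_lt_zero _)⟩
      · obtain ⟨v, hv⟩ := Finset.card_le_one_iff_subset_singleton.1 (hΓ p hk0)
        refine ⟨v, fun l hl => (Finset.inter_subset_inter_right ?_).trans hv⟩
        exact Finset.subset_biUnion_of_mem Γ (by simpa [Fin.lt_def, p] using hl)
    let D := (Γ p).erase v
    have hdiag : ∀ (e : Fin n → ℝ) (c : ℝ) (x : Fin n → ℝ),
        ∑ i, e i * (c * x i) ^ M = c ^ M * ∑ i, e i * x i ^ M := fun e c x => by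
      rw [Finset.mul_sum]
      exact Finset.sum_congr rfl fun i _ => by ring
    obtain ⟨θ, hθ1, hθ2⟩ := exists_shift_nonneg hM hM0
      (F := fun x => ∑ i, (if i ∈ D then 0 else d i) * x i ^ M
        - ∑ l with l.val < k, subTmul (Γ l) (B l) x)
      (H := fun x => ∑ i, (if i ∈ D then d i else 0) * x i ^ M - subTmul (Γ p) (B p) x)
      D v (by simp [D])
      (by
        intro x y hxy
        congr 1
        · refine Finset.sum_congr rfl fun i _ => ?_
          split_ifs with hi
          · simp
          · rw [hxy i hi]
        · refine Finset.sum_congr rfl fun l hl => subTmul_congr _ fun i hi => hxy i fun hiD => ?_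
          have hiD' := Finset.mem_erase.1 hiD
          exact hiD'.1 (Finset.mem_singleton.1 (hv l (by simpa using hl)
            (Finset.mem_inter.2 ⟨hi, hiD'.2⟩))))
      (by
        intro x y hxy
        congr 1
        · refine Finset.sum_congr rfl fun i _ => ?_
          split_ifs with hi
          · rw [hxy i (Finset.mem_insert_of_mem hi)]
          · simp
        · refine subTmul_congr _ fun i hi => hxy i ?_
          by_cases hiv : i = v
          · exact hiv ▸ Finset.mem_insert_self _ _
          · exact Finset.mem_insert_of_mem (Finset.mem_erase.2 ⟨hiv, hi⟩))
      (fun c x => by simp only [hdiag, subTmul_smul, ← Finset.mul_sum, mul_sub])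
      (fun c x => by simp only [hdiag, subTmul_smul, mul_sub])
      (fun x => by
        have := h x
        rw [hsum] at this
        refine this.trans_eq ?_
        have e : ∑ i, d i * x i ^ M = ∑ i, (if i ∈ D then 0 else d i) * x i ^ M
            + ∑ i, (if i ∈ D then d i else 0) * x i ^ M := by
          rw [← Finset.sum_add_distrib]
          exact Finset.sum_congr rfl fun i _ => by split_ifs <;> ring
        rw [e]
        ring)
    have hθd : ∀ x : Fin n → ℝ, θ * x v ^ M = ∑ i, (if i = v then θ else 0) * x i ^ M :=
      fun x => by simp
    have h1 := ih (by omega) (fun i => (if i ∈ D then 0 else d i) + if i = v then θ else 0)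
      fun x => by
        have := hθ1 x
        rw [hθd] at this
        simp only [add_mul, Finset.sum_add_distrib]
        linarith
    have h2 := (hB p).isSOSFun hM hM2
      (fun i => (if i ∈ D then d i else 0) - if i = v then θ else 0) fun x => by
        have := hθ2 x
        rw [hθd] at this
        simp only [sub_mul, Finset.sum_sub_distrib]
        linarith
    refine (h1.add h2).congr fun x => ?_
    have e : ∑ i, d i * x i ^ M
        = ∑ i, ((if i ∈ D then 0 else d i) + if i = v then θ else 0) * x i ^ M
          + ∑ i, ((if i ∈ D then d i else 0) - if i = v then θ else 0) * x i ^ M := by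
      rw [← Finset.sum_add_distrib]
      exact Finset.sum_congr rfl fun i _ => by split_ifs <;> ring
    rw [hsum, e]
    ring

theorem isSOSPoly_iff_isSumSq {σ : Type*} {p : MvPolynomial σ ℝ} : IsSOSPoly p ↔ IsSumSq p := by
  constructor
  · rintro ⟨r, q, rfl⟩
    exact IsSumSq.sum_sq _ _
  · intro h
    induction h with
    | zero => exact ⟨0, Fin.elim0, by simp⟩
    | sq_add a _ ih =>
      obtain ⟨r, q, rfl⟩ := ih
      exact ⟨r + 1, Fin.cons a q, by simp [Fin.sum_univ_succ, sq]⟩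

theorem IsSOSPoly.eval_nonneg {σ : Type*} {p : MvPolynomial σ ℝ} (h : IsSOSPoly p) (x : σ → ℝ) :
    0 ≤ eval x p := by
  obtain ⟨r, q, rfl⟩ := h
  rw [map_sum]
  exact Finset.sum_nonneg fun j _ => by rw [map_pow]; positivity

theorem eval_tpoly {m n : ℕ} (A : (Fin m → Fin n) → ℝ) (x : Fin n → ℝ) :
    eval x (tpoly A) = tmul A x := by
  simp [tpoly, tmul]

theorem tmul_smul {m n : ℕ} (A : (Fin m → Fin n) → ℝ) (c : ℝ) (x : Fin n → ℝ) :
    tmul A (fun i => c * x i) = c ^ m * tmul A x := by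
  simp only [tmul, Finset.mul_sum, Finset.prod_mul_distrib, Finset.prod_const, Finset.card_fin]
  exact Finset.sum_congr rfl fun g _ => by ring

theorem sum_cons_eq {m n : ℕ} (F : (Fin (m + 1) → Fin n) → ℝ) :
    ∑ g, F g = ∑ i, ∑ g : Fin m → Fin n, F (Fin.cons i g) := by
  rw [← Fintype.sum_prod_type', ← (Fin.consEquiv fun _ => Fin n).sum_comp]
  rfl

theorem tmul_eq_sum_mul {m n : ℕ} (A : (Fin (m + 1) → Fin n) → ℝ) (x : Fin n → ℝ) :
    tmul A x = ∑ i, x i * ∑ g : Fin m → Fin n, A (Fin.cons i g) * ∏ j, x (g j) := by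
  rw [tmul, sum_cons_eq]
  refine Finset.sum_congr rfl fun i _ => ?_
  rw [Finset.mul_sum]
  refine Finset.sum_congr rfl fun g _ => ?_
  rw [Fin.prod_univ_succ]
  simp only [Fin.cons_zero, Fin.cons_succ]
  ring

/-- The partial derivatives of the form of a symmetric tensor. -/
theorem IsSymT.hasDerivAt_tmul {m n : ℕ} {A : (Fin (m + 1) → Fin n) → ℝ} (hA : IsSymT A)
    (u : Fin n → ℝ) (i : Fin n) :
    HasDerivAt (fun t : ℝ => tmul A fun k => u k + t * if k = i then 1 else 0)
      ((m + 1) * ∑ g : Fin m → Fin n, A (Fin.cons i g) * ∏ j, u (g j)) 0 := by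
  classical
  let s : Fin n → ℝ := fun k => if k = i then 1 else 0
  have hlin : ∀ k, HasDerivAt (fun t : ℝ => u k + t * s k) (s k) 0 := fun k => by
    simpa using ((hasDerivAt_id (0 : ℝ)).mul_const (s k)).const_add (u k)
  have h1 : HasDerivAt (fun t : ℝ => tmul A fun k => u k + t * s k)
      (∑ g : Fin (m + 1) → Fin n, A g * ∑ j, (∏ k ∈ univ.erase j, u (g k)) * s (g j)) 0 := by
    refine HasDerivAt.fun_sum fun g _ => HasDerivAt.const_mul _ ?_
    simpa using HasDerivAt.fun_finsetProd (u := univ) (f := fun j (t : ℝ) => u (g j) + t * s (g j))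
      (f' := fun j => s (g j)) (x := 0) fun j _ => hlin (g j)
  refine h1.congr_deriv ?_
  have h2 : ∀ j : Fin (m + 1),
      ∑ g : Fin (m + 1) → Fin n, A g * ((∏ k ∈ univ.erase j, u (g k)) * s (g j))
        = ∑ g : Fin m → Fin n, A (Fin.cons i g) * ∏ k, u (g k) := by
    intro j
    have h3 : ∀ F : (Fin (m + 1) → Fin n) → ℝ, ∑ g, F g = ∑ g, F (g ∘ Equiv.swap 0 j) := fun F =>
      ((Equiv.arrowCongr (Equiv.swap 0 j) (Equiv.refl (Fin n))).sum_comp F).symm.trans (by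
        refine Finset.sum_congr rfl fun g _ => ?_
        rfl)
    rw [h3, sum_cons_eq]
    have h4 : ∀ (a : Fin n) (g : Fin m → Fin n),
        A ((Fin.cons a g : Fin (m + 1) → Fin n) ∘ Equiv.swap 0 j) *
          ((∏ k ∈ univ.erase j, u (((Fin.cons a g : Fin (m + 1) → Fin n) ∘ Equiv.swap 0 j) k))
            * s (((Fin.cons a g : Fin (m + 1) → Fin n) ∘ Equiv.swap 0 j) j))
        = s a * (A (Fin.cons a g) * ∏ k, u (g k)) := by
      intro a g
      have h5 : ∏ k ∈ univ.erase j, u (((Fin.cons a g : Fin (m + 1) → Fin n) ∘ Equiv.swap 0 j) k)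
          = ∏ k, u (g k) := by
        have h6 : (univ.erase j).map (Equiv.swap 0 j).toEmbedding = univ.erase 0 := by
          ext k
          simp
        have := Finset.prod_map (univ.erase j) (Equiv.swap 0 j).toEmbedding
          fun k => u ((Fin.cons a g : Fin (m + 1) → Fin n) k)
        rw [h6] at this
        refine this.symm.trans ?_
        rw [Fin.univ_succ, Finset.erase_cons, Finset.prod_map]
        simp
      rw [hA, h5]
      simp only [Function.comp_apply, Equiv.swap_apply_right, Fin.cons_zero]
      ring
    simp only [h4, ← Finset.mul_sum]
    simp [s]
  simp only [Finset.mul_sum] at h2 ⊢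
  rw [Finset.sum_comm]
  simp only [h2]
  simp [Finset.mul_sum]

/-- An even-order form attains its maximum on the unit sphere of the `ℓ^M` norm. -/
theorem exists_max_tmul {M n : ℕ} (hn : 0 < n) (hM : Even M) (hM0 : M ≠ 0)
    (A : (Fin M → Fin n) → ℝ) :
    ∃ u : Fin n → ℝ, ∑ i, u i ^ M = 1 ∧ ∀ x, tmul A x ≤ tmul A u * ∑ i, x i ^ M := by
  let S : Set (Fin n → ℝ) := {x | ∑ i, x i ^ M = 1}
  have hS : IsCompact S := by
    refine (isCompact_Icc (a := fun _ : Fin n => (-1 : ℝ)) (b := fun _ => 1)).of_isClosed_subset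
      (isClosed_eq (by fun_prop) continuous_const) fun x hx => ?_
    have hle : ∀ i, |x i| ≤ 1 := fun i => by
      rw [← pow_le_one_iff_of_nonneg (abs_nonneg _) hM0, hM.pow_abs, ← (hx : ∑ i, x i ^ M = 1)]
      exact Finset.single_le_sum (f := fun i => x i ^ M) (fun i _ => hM.pow_nonneg _) (mem_univ i)
    exact ⟨fun i => (abs_le.1 (hle i)).1, fun i => (abs_le.1 (hle i)).2⟩
  have hne : S.Nonempty := by
    refine ⟨Pi.single ⟨0, hn⟩ 1, ?_⟩
    show ∑ i, _ = _
    rw [Finset.sum_eq_single ⟨0, hn⟩ (fun k _ hk => by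
        rw [Pi.single_eq_of_ne hk, zero_pow hM0]) (by simp)]
    simp
  have hcont : Continuous (tmul A) := by
    unfold tmul
    fun_prop
  obtain ⟨u, hu, hmax⟩ := hS.exists_isMaxOn hne hcont.continuousOn
  refine ⟨u, hu, fun x => ?_⟩
  have hN : 0 ≤ ∑ i, x i ^ M := Finset.sum_nonneg fun i _ => hM.pow_nonneg _
  rcases hN.eq_or_lt with h0 | hpos
  · have hx : x = fun i => 0 * x i := by
      funext i
      have := (Finset.sum_eq_zero_iff_of_nonneg fun i _ => hM.pow_nonneg (x i)).1 h0.symm i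
        (mem_univ i)
      rw [zero_mul]
      exact (pow_eq_zero_iff hM0).1 this
    rw [← h0, hx, tmul_smul, zero_pow hM0]
    simp
  · let c : ℝ := (∑ i, x i ^ M) ^ ((M : ℝ)⁻¹)
    have hc : c ^ M = ∑ i, x i ^ M := Real.rpow_inv_natCast_pow hN hM0
    have hcp : 0 < c := Real.rpow_pos_of_pos hpos _
    have hmem : (fun i => c⁻¹ * x i) ∈ S := by
      show ∑ i, (c⁻¹ * x i) ^ M = 1
      simp only [mul_pow, ← Finset.mul_sum, ← hc]
      rw [← mul_pow, inv_mul_cancel₀ hcp.ne', one_pow]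
    have := hmax hmem
    rw [Set.mem_ofPred_eq, tmul_smul, inv_pow, hc] at this
    rwa [inv_mul_le_iff₀' hpos] at this

/-- Theorem 3.2, equation (3.2): for an even-order symmetric W-tensor,
`λ_max(𝒜) = min { t | ∃ μ, t − 𝒜x^m + μ(∑ x_i^m − 1) is SOS }`, and the minimum
is attained (in particular at `t = μ = λ_max(𝒜)`). -/
theorem theorem32_first (m n : ℕ) (hn : 0 < n) (heven : Even (m + 1))
    (A : (Fin (m + 1) → Fin n) → ℝ) (hsym : IsSymT A) (hW : IsWTensor A) :
    ∃ lmax : ℝ, IsHEig A lmax ∧ (∀ lam : ℝ, IsHEig A lam → lam ≤ lmax) ∧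
      IsLeast {t : ℝ | ∃ μ : ℝ, IsSOSPoly
          (MvPolynomial.C t - tpoly A
            + MvPolynomial.C μ * ((∑ i, MvPolynomial.X i ^ (m + 1)) - 1))} lmax ∧
      IsSOSPoly (MvPolynomial.C lmax - tpoly A
            + MvPolynomial.C lmax * ((∑ i, MvPolynomial.X i ^ (m + 1)) - 1)) := by
  obtain ⟨u, hu, hmax⟩ := exists_max_tmul hn heven m.succ_ne_zero A
  have hsos : IsSOSPoly (C (tmul A u) - tpoly A
      + C (tmul A u) * ((∑ i, X i ^ (m + 1)) - 1)) := by
    obtain ⟨s, Γ, B, -, -, -, -, hΓ, hdec, hB⟩ := hW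
    have hdec' : ∀ x, tmul A x = ∑ l with l.val < s, subTmul (Γ l) (B l) x := fun x => by
      rw [hdec x, Finset.filter_true_of_mem fun l _ => l.2]
    have hM2 : 2 ≤ m + 1 := by
      obtain ⟨k, hk⟩ := heven
      omega
    obtain ⟨p, hp, he⟩ := hΓ.isSOSFun hn heven hM2 hB s le_rfl (fun _ => tmul A u) fun x => by
      rw [← hdec' x, ← Finset.mul_sum]
      exact sub_nonneg.2 (hmax x)
    rw [isSOSPoly_iff_isSumSq]
    convert hp using 1
    refine MvPolynomial.funext fun x => ?_
    rw [he]
    beta_reduce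
    rw [← hdec' x, ← Finset.mul_sum]
    simp [eval_tpoly]
    ring
  refine ⟨tmul A u, ⟨u, ?_, fun i => ?_⟩, ?_, ⟨⟨_, hsos⟩, ?_⟩, hsos⟩
  · rintro rfl
    simp at hu
  · have hd : HasDerivAt (fun t : ℝ =>
        tmul A u * (∑ k, (u k + t * if k = i then 1 else 0) ^ (m + 1))
          - tmul A fun k => u k + t * if k = i then 1 else 0)
        (tmul A u * (∑ k, ((m + 1 : ℕ) : ℝ) * u k ^ m * if k = i then 1 else 0)
          - (m + 1) * ∑ g : Fin m → Fin n, A (Fin.cons i g) * ∏ j, u (g j)) 0 := by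
      refine HasDerivAt.sub (HasDerivAt.const_mul _ (HasDerivAt.fun_sum fun k _ => ?_))
        (hsym.hasDerivAt_tmul u i)
      simpa using ((((hasDerivAt_id (0 : ℝ)).mul_const
        (if k = i then (1 : ℝ) else 0)).const_add (u k)).fun_pow (m + 1))
    have hmin : IsLocalMin (fun t : ℝ =>
        tmul A u * (∑ k, (u k + t * if k = i then 1 else 0) ^ (m + 1))
          - tmul A fun k => u k + t * if k = i then 1 else 0) 0 := by
      refine Filter.Eventually.of_forall fun t => ?_
      simpa [hu] using hmax fun k => u k + t * if k = i then 1 else 0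
    have := hmin.hasDerivAt_eq_zero hd
    simp only [mul_ite, mul_one, mul_zero, Finset.sum_ite_eq', Finset.mem_univ, if_true] at this
    push_cast at this
    have hm : (m : ℝ) + 1 ≠ 0 := by positivity
    apply mul_left_cancel₀ hm
    linarith
  · rintro lam ⟨x, hx, he⟩
    have h1 : tmul A x = lam * ∑ i, x i ^ (m + 1) := by
      rw [tmul_eq_sum_mul, Finset.mul_sum]
      refine Finset.sum_congr rfl fun i _ => ?_
      rw [he i]
      ring
    have h2 := hmax x
    rw [h1] at h2
    refine le_of_mul_le_mul_right h2 ?_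
    obtain ⟨i, hi⟩ := Function.ne_iff.1 hx
    exact Finset.sum_pos' (fun i _ => heven.pow_nonneg _) ⟨i, mem_univ i, heven.pow_pos hi⟩
  · rintro t ⟨μ, ht⟩
    have := ht.eval_nonneg u
    simp [eval_tpoly, hu] at this
    exact this

end
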